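/- Let Γ ⊆ Iso(ℝⁿ_s) be a subgroup having the Wolf properties and suppose there exist (I+A₁, v₁), (I+A₂, v₂) ∈ Γ with A₁A₂ ≠ 0. Then ℝⁿ_s contains a totally isotropic subspace of dimension at least 4; in particular s ≥ 4. -/

import Mathlib

noncomputable section

/-- `ℝⁿ` as a coordinate space. -/
abbrev E (n : ℕ) : Type := Fin n → ℝ

/-- The standard symmetric bilinear form of signature `(n-s, s)` on `ℝⁿ`. -/
def B (n s : ℕ) : LinearMap.BilinForm ℝ (E n) :=
  LinearMap.mk₂ ℝ
    (fun x y => ∑ i : Fin n, (if (i : ℕ) < n - s then x i * y i else -(x i * y i)))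
    (by
      intro x x' y
      rw [← Finset.sum_add_distrib]
      refine Finset.sum_congr rfl fun i _ => ?_
      by_cases h : (i : ℕ) < n - s <;> simp [h] <;> ring)
    (by
      intro c x y
      rw [Finset.smul_sum]
      refine Finset.sum_congr rfl fun i _ => ?_
      by_cases h : (i : ℕ) < n - s <;> simp [h] <;> ring)
    (by
      intro x y y'
      rw [← Finset.sum_add_distrib]
      refine Finset.sum_congr rfl fun i _ => ?_
      by_cases h : (i : ℕ) < n - s <;> simp [h] <;> ring)
    (by
      intro c x y
      rw [Finset.smul_sum]
      refine Finset.sum_congr rfl fun i _ => ?_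
      by_cases h : (i : ℕ) < n - s <;> simp [h] <;> ring)

/-- Orthogonal complement (w.r.t. the form `B n s`) of a set `S ⊆ ℝⁿ`. -/
def perp (n s : ℕ) (S : Set (E n)) : Set (E n) :=
  {x | ∀ w ∈ S, B n s x w = 0}

/-- A set of vectors is totally isotropic if the form vanishes identically on it. -/
def TotallyIsotropicSet (n s : ℕ) (U : Set (E n)) : Prop :=
  ∀ u ∈ U, ∀ u' ∈ U, B n s u u' = 0

/-- The set `T(D)` of translations preserving `D`. -/
def TransSet (n : ℕ) (D : Set (E n)) : Set (E n) :=
  {v | ∀ x ∈ D, v + x ∈ D}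

/-- `D` is translationally isotropic if `T(D)^⊥ ⊆ T(D)`. -/
def TranslationallyIsotropic (n s : ℕ) (D : Set (E n)) : Prop :=
  perp n s (TransSet n D) ⊆ TransSet n D

/-- The group of invertible affine transformations of `ℝⁿ`. -/
abbrev Aff (n : ℕ) : Type := (E n) ≃ᵃ[ℝ] (E n)

/-- The affine isometries of `ℝⁿ_s`: affine transformations whose linear part
preserves the bilinear form. -/
def Iso (n s : ℕ) : Set (Aff n) :=
  {g | ∀ x y : E n, B n s (g.linear x) (g.linear y) = B n s x y}

/-- For `γ = (I + A, v)`, the matrix `A`, i.e. the linear part minus the identity. -/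
def linA (n : ℕ) (γ : Aff n) : (E n) →ₗ[ℝ] (E n) :=
  γ.linear.toLinearMap - LinearMap.id

/-- The translation part `v` of an affine transformation. -/
def transPart (n : ℕ) (γ : Aff n) : E n := γ 0

/-- The Wolf properties of a single affine isometry `γ = (I + A, v)`:
`A² = 0`, `Av = 0`, `im A` totally isotropic, `v ⊥ im A`,
`im A = (ker A)^⊥` and `ker A = (im A)^⊥`. -/
def WolfElt (n s : ℕ) (γ : Aff n) : Prop :=
  linA n γ ∘ₗ linA n γ = 0 ∧
  linA n γ (transPart n γ) = 0 ∧
  TotallyIsotropicSet n s (LinearMap.range (linA n γ) : Set (E n)) ∧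
  transPart n γ ∈ perp n s (LinearMap.range (linA n γ) : Set (E n)) ∧
  (LinearMap.range (linA n γ) : Set (E n)) = perp n s (LinearMap.ker (linA n γ) : Set (E n)) ∧
  (LinearMap.ker (linA n γ) : Set (E n)) = perp n s (LinearMap.range (linA n γ) : Set (E n))

/-- The linear holonomy group `Hol(Γ)` (the group of linear parts) is abelian. -/
def HolAbelian (n : ℕ) (Γ : Subgroup (Aff n)) : Prop :=
  ∀ γ₁ ∈ Γ, ∀ γ₂ ∈ Γ,
    γ₁.linear.toLinearMap ∘ₗ γ₂.linear.toLinearMap =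
      γ₂.linear.toLinearMap ∘ₗ γ₁.linear.toLinearMap

/-- The centraliser of `Γ` in `Iso(ℝⁿ_s)`. -/
def CentrIso (n s : ℕ) (Γ : Subgroup (Aff n)) : Set (Aff n) :=
  {g ∈ Iso n s | ∀ γ ∈ Γ, g * γ = γ * g}

/-- The subspace `U_Γ = ∑_{(I+A,v) ∈ Γ} im A`. -/
def UGamma (n : ℕ) (Γ : Subgroup (Aff n)) : Submodule ℝ (E n) :=
  ⨆ γ ∈ Γ, LinearMap.range (linA n γ)

/-- The set `U₀ = U_Γ ∩ U_Γ^⊥`. -/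
def U0 (n s : ℕ) (Γ : Subgroup (Aff n)) : Set (E n) :=
  (UGamma n Γ : Set (E n)) ∩ perp n s (UGamma n Γ : Set (E n))

/-- The translation `τ_u : x ↦ u + x` as an affine transformation. -/
def τ (n : ℕ) (u : E n) : Aff n := AffineEquiv.constVAdd ℝ (E n) u


/-- A totally isotropic subspace has dimension at most `s`. -/
lemma isotropic_finrank_le (n s : ℕ) (hs : s ≤ n) (U : Submodule ℝ (E n))
    (hU : TotallyIsotropicSet n s (U : Set (E n))) : Module.finrank ℝ U ≤ s := by
  let f : (E n) →ₗ[ℝ] (Fin s → ℝ) :=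
    LinearMap.funLeft ℝ ℝ (fun j : Fin s => (⟨n - s + j, by omega⟩ : Fin n))
  have hf : Function.Injective (f ∘ₗ U.subtype) := by
    rw [← LinearMap.ker_eq_bot, LinearMap.ker_eq_bot']
    rintro ⟨x, hx⟩ h
    have h0 : ∀ i : Fin n, ¬ (i : ℕ) < n - s → x i = 0 := by
      intro i hi
      have h1 := congrFun h ⟨i - (n - s), by omega⟩
      have h2 : x ⟨n - s + (i - (n - s)), by omega⟩ = 0 := h1
      have h3 : (⟨n - s + (i - (n - s)), by omega⟩ : Fin n) = i := by
        apply Fin.ext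
        simp only
        omega
      rwa [h3] at h2
    have hB := hU x hx x hx
    have hB' : ∑ i : Fin n, (if (i : ℕ) < n - s then x i * x i else -(x i * x i)) = 0 := hB
    have hs' : ∑ i : Fin n, x i * x i = 0 := by
      rw [← hB']
      refine Finset.sum_congr rfl fun i _ => ?_
      split_ifs with hi
      · rfl
      · simp [h0 i hi]
    rw [Finset.sum_eq_zero_iff_of_nonneg (fun i _ => mul_self_nonneg _)] at hs'
    apply Subtype.ext
    funext i
    exact mul_self_eq_zero.mp (hs' i (Finset.mem_univ i))
  have := LinearMap.finrank_le_finrank_of_injective hf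
  simpa using this

lemma B_symm (n s : ℕ) (x y : E n) : B n s x y = B n s y x := by
  change ∑ i : Fin n, (if (i : ℕ) < n - s then x i * y i else -(x i * y i)) =
    ∑ i : Fin n, (if (i : ℕ) < n - s then y i * x i else -(y i * x i))
  refine Finset.sum_congr rfl fun i _ => ?_
  rw [mul_comm]

lemma B_nondeg (n s : ℕ) (x : E n) (h : ∀ y, B n s x y = 0) : x = 0 := by
  funext i
  have h1 : ∑ j : Fin n, (if (j : ℕ) < n - s then x j * (Pi.single i 1 : E n) j
      else -(x j * (Pi.single i 1 : E n) j)) = 0 := h (Pi.single i 1)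
  rw [Finset.sum_eq_single i] at h1
  · split_ifs at h1 <;> simpa using h1
  · intro j _ hj
    simp [hj]
  · simp

lemma linA_skew (n s : ℕ) (γ : Aff n) (hI : γ ∈ Iso n s) (hW : WolfElt n s γ) (x y : E n) :
    B n s (linA n γ x) y = - B n s x (linA n γ y) := by
  have h := hI x y
  have e : ∀ z, γ.linear z = linA n γ z + z := by
    intro z
    simp [linA]
  have h3 := hW.2.2.1 _ ⟨x, rfl⟩ _ ⟨y, rfl⟩
  rw [e, e] at h
  simp only [map_add, LinearMap.add_apply] at h
  linarith

lemma linA_anticomm (n s : ℕ) (γ₁ γ₂ : Aff n) (h1 : WolfElt n s γ₁) (h2 : WolfElt n s γ₂)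
    (h12 : WolfElt n s (γ₁ * γ₂)) :
    linA n γ₁ * linA n γ₂ = - (linA n γ₂ * linA n γ₁) := by
  have a := h1.1
  have c := h2.1
  have p := h12.1
  have e : linA n (γ₁ * γ₂) = linA n γ₁ + linA n γ₂ + linA n γ₁ * linA n γ₂ := by
    apply LinearMap.ext
    intro x
    have : (γ₁ * γ₂).linear x = γ₁.linear (γ₂.linear x) := rfl
    simp [linA, this]
  rw [e] at p
  generalize linA n γ₁ = A at *
  generalize linA n γ₂ = C at *
  change A * A = 0 at a
  change C * C = 0 at c
  change (A + C + A * C) * (A + C + A * C) = 0 at p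
  have q : A * C + C * A + C * A * C + A * C * A + A * C * A * C = 0 := by
    have : (A + C + A * C) * (A + C + A * C) = A * A + C * C + (A * A) * C + A * (C * C)
      + A * (C * C) * 0 + A * C + C * A + C * A * C + A * C * A + A * C * A * C := by
      noncomm_ring
    rw [this, a, c] at p
    simpa using p
  have q1 : A * C * A * C = 0 := by
    have : A * (A * C + C * A + C * A * C + A * C * A + A * C * A * C) * C
      = (A * A) * (C * C) + A * C * A * C + A * C * A * (C * C) + (A * A) * C * A * C
        + (A * A) * C * A * (C * C) := by noncomm_ring
    rw [q, a, c] at this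
    simpa using this.symm
  have q2 : A * C * A = 0 := by
    have : A * (A * C + C * A + C * A * C + A * C * A + A * C * A * C)
      = (A * A) * C + A * C * A + A * C * A * C + (A * A) * C * A
        + (A * A) * C * A * C := by noncomm_ring
    rw [q, a, q1] at this
    simpa using this.symm
  have q3 : C * A * C = 0 := by
    have : (A * C + C * A + C * A * C + A * C * A + A * C * A * C) * C
      = A * (C * C) + C * A * C + C * A * (C * C) + A * C * A * C
        + A * C * A * (C * C) := by noncomm_ring
    rw [q, c, q1] at this
    simpa using this.symm
  rw [q1, q2, q3] at q
  exact eq_neg_of_add_eq_zero_left (by simpa using q)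

/-- If `Γ ⊆ Iso(ℝⁿ_s)` is a subgroup with the Wolf properties
containing elements `(I+A₁,v₁)` and `(I+A₂,v₂)` with `A₁A₂ ≠ 0`, then `ℝⁿ_s`
contains a totally isotropic subspace of dimension at least `4`; in particular
`s ≥ 4`. -/
theorem nonvanishing_product_gives_isotropic_subspace
    (n s : ℕ) (hn : 1 ≤ n) (hs : s ≤ n)
    (Γ : Subgroup (Aff n)) (hΓIso : (Γ : Set (Aff n)) ⊆ Iso n s)
    (hWolf : ∀ γ ∈ Γ, WolfElt n s γ)
    (γ₁ γ₂ : Aff n) (hγ₁ : γ₁ ∈ Γ) (hγ₂ : γ₂ ∈ Γ)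
    (hA : linA n γ₁ ∘ₗ linA n γ₂ ≠ 0) :
    (∃ U : Submodule ℝ (E n), TotallyIsotropicSet n s (U : Set (E n)) ∧
      4 ≤ Module.finrank ℝ U) ∧ 4 ≤ s := by
  have W1 := hWolf _ hγ₁
  have W2 := hWolf _ hγ₂
  have hc := linA_anticomm n s γ₁ γ₂ W1 W2 (hWolf _ (Γ.mul_mem hγ₁ hγ₂))
  have k1 := linA_skew n s γ₁ (hΓIso hγ₁) W1
  have k2 := linA_skew n s γ₂ (hΓIso hγ₂) W2
  have iso : TotallyIsotropicSet n s (LinearMap.range (linA n γ₁) : Set (E n)) := W1.2.2.1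
  have a2 : ∀ x, linA n γ₂ (linA n γ₂ x) = 0 := fun x => LinearMap.congr_fun W2.1 x
  have hcx : ∀ x, linA n γ₂ (linA n γ₁ x) = - linA n γ₁ (linA n γ₂ x) := by
    intro x
    have : linA n γ₁ (linA n γ₂ x) = - linA n γ₂ (linA n γ₁ x) := LinearMap.congr_fun hc x
    rw [this, neg_neg]
  have key : 4 ≤ Module.finrank ℝ (LinearMap.range (linA n γ₁)) := by
    generalize linA n γ₁ = A at *
    generalize linA n γ₂ = C at *
    obtain ⟨x, y, hxy⟩ : ∃ x y, B n s (A (C x)) y ≠ 0 := by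
      by_contra hcon
      push Not at hcon
      exact hA (LinearMap.ext fun x => B_nondeg n s _ (hcon x))
    have sk : ∀ u v, B n s (A (C u)) v = - B n s (A (C v)) u := by
      intro u v
      rw [k1, k2, hcx, map_neg, B_symm n s u]
      ring
    have sk0 : ∀ u, B n s (A (C u)) u = 0 := by
      intro u
      have := sk u u
      linarith
    have two : ∀ a b : ℝ, a • A (C x) + b • A (C y) = 0 → a = 0 ∧ b = 0 := by
      intro a b h
      have h1 : B n s (a • A (C x) + b • A (C y)) y = 0 := by rw [h]; simp
      have h2 : B n s (a • A (C x) + b • A (C y)) x = 0 := by rw [h]; simp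
      simp only [map_add, map_smul, LinearMap.add_apply, LinearMap.smul_apply, sk0,
        smul_eq_mul, mul_zero, add_zero, zero_add] at h1 h2
      rw [sk y x] at h2
      constructor
      · simpa [hxy] using h1
      · simpa [hxy] using h2
    have li : LinearIndependent ℝ (fun i : Fin 4 =>
        A.rangeRestrict ((![x, y, C x, C y] : Fin 4 → E n) i)) := by
      rw [Fintype.linearIndependent_iff]
      intro g hg
      have hg' := congrArg Subtype.val hg
      simp only [Fin.sum_univ_four] at hg'
      have hg2 : g 0 • A x + g 1 • A y + g 2 • A (C x) + g 3 • A (C y) = 0 := hg'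
      have h3 := congrArg C hg2
      simp only [map_add, map_smul, hcx, a2, map_zero, neg_zero, smul_zero, add_zero] at h3
      obtain ⟨g0, g1⟩ := two (g 0) (g 1) (by
        rw [← neg_eq_zero, ← h3]
        module)
      rw [g0, g1] at hg2
      obtain ⟨g2, g3⟩ := two (g 2) (g 3) (by simpa using hg2)
      intro i
      fin_cases i <;> assumption
    simpa using li.fintype_card_le_finrank
  exact ⟨⟨_, iso, key⟩, key.trans (isotropic_finrank_le n s hs _ iso)⟩

end
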